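/- With notation from Schikhof's theory of C^n functions on a closed ball B in a complete nonarchimedean field: if f ∈ C^h(B), then for all 0 ≤ i, j with i + j ≤ h, D_j f ∈ C^{h−j}(B) and D_i(D_j f) = binomial(i+j, i) · D_{i+j} f. -/

import Mathlib

/-- Schikhof's `n`-th order difference quotient, acting on sequences (only the
first `n+1` entries are used): `dq f 0 x = f (x 0)` and
`dq f (n+1) (x_0,x_1,x_2,…) = (dq f n (x_0,x_2,…) - dq f n (x_1,x_2,…))/(x_0 - x_1)`. -/
def dq {L : Type*} [Field L] (f : L → L) : ℕ → (ℕ → L) → L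
  | 0, x => f (x 0)
  | n + 1, x =>
      (dq f n (fun i => if i = 0 then x 0 else x (i + 1)) - dq f n (fun i => x (i + 1))) /
        (x 0 - x 1)

open Finset

section Combinatorics

variable {β L : Type*} [Field L]

/-- The sum of `F` over all multisets obtained from `S + {x 0, …, x i}` by repeating the points
`x 0, …, x i` a further `j` times in total. -/
def repeatSum (F : Multiset β → L) : ℕ → (ℕ → β) → Multiset β → ℕ → L
  | 0, x, S, j => F (Multiset.replicate (j + 1) (x 0) + S)
  | i + 1, x, S, j => ∑ p ∈ antidiagonal j,
      repeatSum F i (fun k => x (k + 1)) (Multiset.replicate (p.1 + 1) (x 0) + S) p.2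

/-- `F` behaves like a symmetric divided difference on multisets with at most `N` elements. -/
def IsDividedDiff (v : β → L) (F : Multiset β → L) (N : ℕ) : Prop :=
  ∀ s a b, s.card + 2 ≤ N → F (a ::ₘ s) - F (b ::ₘ s) = (v a - v b) * F (a ::ₘ b ::ₘ s)

theorem replicate_sub_replicate {v : β → L} {F : Multiset β → L} {N : ℕ}
    (hF : IsDividedDiff v F N) (a b : β) (e : ℕ) (s : Multiset β) (hs : s.card + e + 2 ≤ N) :
    F (Multiset.replicate (e + 1) a + s) - F (Multiset.replicate (e + 1) b + s) =
      (v a - v b) * ∑ p ∈ antidiagonal e,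
        F (Multiset.replicate (p.2 + 1) b + (Multiset.replicate (p.1 + 1) a + s)) := by
  induction e generalizing s with
  | zero =>
    have := hF s a b (by omega)
    simpa [Multiset.cons_swap] using this
  | succ e ih =>
    have h1 := ih (a ::ₘ s) (by simp; omega)
    have h2 := hF (Multiset.replicate (e + 1) b + s) a b (by simp; omega)
    rw [Nat.sum_antidiagonal_succ]
    simp only [Multiset.add_cons, Multiset.replicate_succ _ (_ + 1), Multiset.cons_add,
      zero_add] at h1 h2 ⊢
    rw [Multiset.replicate_succ _ 0, Multiset.replicate_zero, mul_add, ← h1, Multiset.cons_add,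
      Multiset.zero_add, Multiset.add_cons, Multiset.cons_swap b a, ← h2]
    ring

theorem isDividedDiff_repeatSum {v : β → L} {F : Multiset β → L} {N : ℕ}
    (hF : IsDividedDiff v F N) (i : ℕ) (x : ℕ → β) (j : ℕ) :
    IsDividedDiff v (fun s => repeatSum F i x s j) (N - (i + j + 1)) := by
  induction i generalizing x j with
  | zero =>
    intro s a b hs
    have := hF (Multiset.replicate (j + 1) (x 0) + s) a b (by simp; omega)
    simpa [repeatSum] using this
  | succ i ih =>
    intro s a b hs
    simp only [repeatSum, ← sum_sub_distrib, mul_sum]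
    refine sum_congr rfl fun p hp => ?_
    have := ih (fun k => x (k + 1)) p.2 (Multiset.replicate (p.1 + 1) (x 0) + s) a b (by
      rw [HasAntidiagonal.mem_antidiagonal] at hp
      simp; omega)
    simpa using this

theorem sum_antidiagonal_assoc {M : Type*} [AddCommMonoid M] (G : ℕ → ℕ → ℕ → M) (n : ℕ) :
    ∑ p ∈ antidiagonal n, ∑ q ∈ antidiagonal p.1, G q.1 q.2 p.2 =
      ∑ p ∈ antidiagonal n, ∑ q ∈ antidiagonal p.2, G p.1 q.1 q.2 := by
  rw [sum_sigma', sum_sigma']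
  refine sum_nbij' (fun p => ⟨(p.2.1, p.2.2 + p.1.2), (p.2.2, p.1.2)⟩)
    (fun p => ⟨(p.1.1 + p.2.1, p.2.2), (p.1.1, p.2.1)⟩) ?_ ?_ ?_ ?_ ?_ <;>
  · rintro ⟨⟨a, b⟩, c, d⟩ h
    simp only [mem_sigma, HasAntidiagonal.mem_antidiagonal] at h
    obtain ⟨rfl, rfl⟩ := h
    simp [add_assoc]

theorem repeatSum_sub_repeatSum {v : β → L} {F : Multiset β → L} {N : ℕ}
    (hF : IsDividedDiff v F N) (i : ℕ) (x : ℕ → β) (j : ℕ) (hN : i + j + 2 ≤ N) :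
    repeatSum F i (fun k => if k = 0 then x 0 else x (k + 1)) 0 j -
      repeatSum F i (fun k => x (k + 1)) 0 j =
      (v (x 0) - v (x 1)) * repeatSum F (i + 1) x 0 j := by
  cases i with
  | zero =>
    have := replicate_sub_replicate hF (x 0) (x 1) j 0 (by simp; omega)
    simpa [repeatSum] using this
  | succ i =>
    simp only [repeatSum, ← sum_sub_distrib]
    rw [← sum_antidiagonal_assoc (fun a c d => repeatSum F i (fun k => x (k + 1 + 1))
      (Multiset.replicate (c + 1) (x (0 + 1)) + (Multiset.replicate (a + 1) (x 0) + 0)) d), mul_sum]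
    refine sum_congr rfl fun p hp => ?_
    rw [HasAntidiagonal.mem_antidiagonal] at hp
    have := replicate_sub_replicate (isDividedDiff_repeatSum hF i (fun k => x (k + 1 + 1)) p.2) (x 0) (x 1) p.1 0
      (by simp; omega)
    simpa using this

theorem repeatSum_eq_dq {v : β → L} {F : Multiset β → L} {N : ℕ}
    (hF : IsDividedDiff v F N) {g : L → L} {j : ℕ}
    (hg : ∀ b, F (Multiset.replicate (j + 1) b) = g (v b)) (i : ℕ) (hN : i + j + 1 ≤ N)
    (x : ℕ → β) (hx : ∀ k l, k ≤ i → l ≤ i → k ≠ l → v (x k) ≠ v (x l)) :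
    repeatSum F i x 0 j = dq g i (fun k => v (x k)) := by
  induction i generalizing x with
  | zero => simpa only [repeatSum, dq, add_zero] using hg (x 0)
  | succ i ih =>
    rw [dq, eq_div_iff (sub_ne_zero.2 (hx 0 1 (by omega) (by omega) (by omega))), mul_comm,
      ← repeatSum_sub_repeatSum hF i x j (by omega),
      ih (by omega) _ fun k l hk hl hkl => ?_, ih (by omega) _ fun k l hk hl hkl => ?_]
    · simp only [apply_ite v]
    · exact hx _ _ (by omega) (by omega) (by omega)
    · split_ifs <;> exact hx _ _ (by omega) (by omega) (by omega)

theorem repeatSum_const (F : Multiset β → L) (y : β) (i j p : ℕ) :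
    repeatSum F i (fun _ => y) (Multiset.replicate p y) j =
      ((i + j).choose i : L) * F (Multiset.replicate (i + j + 1 + p) y) := by
  induction i generalizing j p with
  | zero => simp only [repeatSum, ← Multiset.replicate_add, zero_add, Nat.choose_zero_right,
      Nat.cast_one, one_mul]
  | succ i ih =>
    simp only [repeatSum, ← Multiset.replicate_add, ih]
    rw [add_right_comm i 1 j, ← sum_antidiagonal_choose_add i j, Nat.cast_sum, sum_mul]
    refine sum_congr rfl fun q hq => ?_
    rw [HasAntidiagonal.mem_antidiagonal] at hq
    rw [show i + q.2 + 1 + (q.1 + 1 + p) = i + j + 1 + 1 + p by omega]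

theorem continuous_repeatSum [TopologicalSpace β] [TopologicalSpace L] [IsTopologicalRing L]
    {F : Multiset β → L} {N : ℕ}
    (hF : ∀ m : Multiset ℕ, 0 < m.card → m.card ≤ N → Continuous fun u : ℕ → β => F (m.map u))
    (i j : ℕ) (σ : ℕ → ℕ) (m : Multiset ℕ) (hN : m.card + i + j + 1 ≤ N) :
    Continuous fun u : ℕ → β => repeatSum F i (fun k => u (σ k)) (m.map u) j := by
  induction i generalizing j σ m with
  | zero =>
    simpa [repeatSum] using hF (Multiset.replicate (j + 1) (σ 0) + m) (by simp) (by simp; omega)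
  | succ i ih =>
    simp only [repeatSum]
    refine continuous_finsetSum _ fun p hp => ?_
    rw [HasAntidiagonal.mem_antidiagonal] at hp
    simpa using ih p.2 (fun k => σ (k + 1)) (Multiset.replicate (p.1 + 1) (σ 0) + m)
      (by simp; omega)

end Combinatorics

section Symmetry

variable {L : Type*} [Field L]

open Classical in
/-- The divided difference of `f` with respect to a finite set of nodes. -/
noncomputable def finsetDividedDiff (f : L → L) (s : Finset L) : L :=
  ∑ x ∈ s, (∏ y ∈ s.erase x, (x - y))⁻¹ * f x

open Classical in
theorem finsetDividedDiff_insert_insert (f : L → L) {a b : L} {T : Finset L} (hab : a ≠ b)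
    (ha : a ∉ T) (hb : b ∉ T) :
    finsetDividedDiff f (insert a (insert b T)) =
      (finsetDividedDiff f (insert a T) - finsetDividedDiff f (insert b T)) / (a - b) := by
  have hab' : a - b ≠ 0 := sub_ne_zero.2 hab
  have key : ∀ z ∈ T, (∏ y ∈ (insert a (insert b T)).erase z, (z - y))⁻¹ * f z =
      ((∏ y ∈ (insert a T).erase z, (z - y))⁻¹ * f z -
        (∏ y ∈ (insert b T).erase z, (z - y))⁻¹ * f z) / (a - b) := by
    intro z hz
    have hza : z ≠ a := fun h => ha (h ▸ hz)
    have hzb : z ≠ b := fun h => hb (h ▸ hz)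
    have h1 : z - a ≠ 0 := sub_ne_zero.2 hza
    have h2 : z - b ≠ 0 := sub_ne_zero.2 hzb
    rw [erase_insert_of_ne hza.symm, erase_insert_of_ne hzb.symm, erase_insert_of_ne hza.symm,
      prod_insert (by simp [hab, ha]), prod_insert (by simp [hb]),
      prod_insert (by simp [ha])]
    field_simp
    ring
  unfold finsetDividedDiff
  rw [sum_insert (by simp [hab, ha]), sum_insert hb, sum_insert ha, sum_insert hb,
    sum_congr rfl key, ← sum_div, sum_sub_distrib, erase_insert (by simp [hab, ha]),
    erase_insert_of_ne hab, erase_insert hb, erase_insert ha,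
    prod_insert ha, prod_insert hb]
  have hba' : b - a ≠ 0 := sub_ne_zero.2 hab.symm
  simp only [mul_inv]
  rw [show b - a = -(a - b) by ring]
  field_simp
  ring

open Classical in
theorem dq_eq_finsetDividedDiff (f : L → L) (n : ℕ) (x : ℕ → L)
    (hx : ∀ k l, k ≤ n → l ≤ n → k ≠ l → x k ≠ x l) :
    dq f n x = finsetDividedDiff f ((range (n + 1)).image x) := by
  induction n generalizing x with
  | zero => simp [dq, finsetDividedDiff]
  | succ n ih =>
    have hT : ∀ m ≤ 1, x m ∉ (range n).image (fun k => x (k + 2)) := by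
      intro m hm h
      obtain ⟨k, hk, hk'⟩ := mem_image.1 h
      rw [mem_range] at hk
      exact hx _ _ (by omega) (by omega) (by omega) hk'
    have e : ∀ (y : ℕ → L) n, (range (n + 1)).image y =
        insert (y 0) ((range n).image fun k => y (k + 1)) := by
      intro y n
      ext z
      simp only [mem_image, mem_range, mem_insert, Nat.exists_lt_succ_left, eq_comm]
    rw [dq, ih _ fun k l hk hl hkl => ?_, ih _ fun k l hk hl hkl => ?_, e, e, e x, e _ n]
    · simpa using (finsetDividedDiff_insert_insert f
        (hx 0 1 (by omega) (by omega) (by omega)) (hT 0 (by omega)) (hT 1 le_rfl)).symm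
    · exact hx _ _ (by omega) (by omega) (by omega)
    · split_ifs <;> exact hx _ _ (by omega) (by omega) (by omega)

theorem dq_perm (f : L → L) (n : ℕ) (x : ℕ → L)
    (hx : ∀ k l, k ≤ n → l ≤ n → k ≠ l → x k ≠ x l) {p : List ℕ} (hp : p.Perm (List.range (n + 1))) :
    dq f n (fun k => x (p.getD k 0)) = dq f n x := by
  classical
  have hlen : p.length = n + 1 := by simpa using hp.length_eq
  have hnd : p.Nodup := hp.nodup_iff.2 List.nodup_range
  rw [dq_eq_finsetDividedDiff f n x hx, dq_eq_finsetDividedDiff]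
  · congr 1
    have : (range (n + 1)).image (fun k => p.getD k 0) = range (n + 1) := by
      ext m
      simp only [mem_image, mem_range]
      rw [← List.mem_range, ← hp.mem_iff, List.mem_iff_getElem]
      constructor
      · rintro ⟨k, hk, rfl⟩
        exact ⟨k, by omega, by simp [hlen, hk]⟩
      · rintro ⟨k, hk, rfl⟩
        exact ⟨k, by omega, by simp [hk]⟩
    conv_rhs => rw [← this, image_image]
    rfl
  · intro k l hk hl hkl
    have hk' : k < p.length := by omega
    have hl' : l < p.length := by omega
    have bound : ∀ m (h : m < p.length), p[m] ≤ n := fun m h => by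
      have := hp.mem_iff.1 (List.getElem_mem h)
      rw [List.mem_range] at this
      omega
    simp only [List.getD_eq_getElem _ _ hk', List.getD_eq_getElem _ _ hl']
    exact hx _ _ (bound _ _) (bound _ _) fun h => hkl ((hnd.getElem_inj_iff).1 h)

end Symmetry

section Density

open Filter Topology

/-- Sequences in a closed ball can be approximated by sequences in the ball whose first `n + 1`
terms are distinct. -/
theorem subset_closure_distinct {L : Type*} [NontriviallyNormedField L] [IsUltrametricDist L]
    (a₀ : L) {r : ℝ} (hr : 0 < r) (n : ℕ) :
    {x : ℕ → L | ∀ k, x k ∈ Metric.closedBall a₀ r} ⊆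
      closure {x : ℕ → L | (∀ k, x k ∈ Metric.closedBall a₀ r) ∧
        ∀ k l, k ≤ n → l ≤ n → k ≠ l → x k ≠ x l} := by
  intro x hx
  let c := Infinite.natEmbedding L
  let y : L → ℕ → L := fun t k => x k + t * if k ≤ n then c k else 0
  have hcont : Continuous y := by fun_prop
  have hlim : Tendsto y (𝓝[≠] 0) (𝓝 x) := by
    have := (hcont.tendsto 0).mono_left (nhdsWithin_le_nhds (s := {0}ᶜ))
    simpa [y] using this
  refine mem_closure_of_tendsto hlim ?_
  have hball : ∀ᶠ t in 𝓝[≠] (0 : L), ∀ k ∈ Set.Iic n, y t k ∈ Metric.closedBall a₀ r := by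
    rw [eventually_all_finite (Set.finite_Iic n)]
    intro k _
    have h1 := tendsto_pi_nhds.1 hlim k
    filter_upwards [h1 (Metric.closedBall_mem_nhds (x k) hr)] with t ht
    rwa [IsUltrametricDist.closedBall_eq_of_mem (hx k)]
  have hne : ∀ᶠ t in 𝓝[≠] (0 : L), ∀ k ∈ Set.Iic n, ∀ l ∈ Set.Iic n, k ≠ l → y t k ≠ y t l := by
    rw [eventually_all_finite (Set.finite_Iic n)]
    intro k hk
    rw [eventually_all_finite (Set.finite_Iic n)]
    intro l hl
    rw [eventually_imp_distrib_left]
    intro hkl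
    have hc : c k - c l ≠ 0 := sub_ne_zero.2 fun h => hkl (c.injective h)
    have : ∀ᶠ t in 𝓝[≠] (0 : L), t ≠ (x l - x k) / (c k - c l) :=
      nhdsNE_le_cofinite 0 (Set.finite_singleton _).compl_mem_cofinite
    filter_upwards [this] with t ht h
    apply ht
    rw [eq_div_iff hc]
    simp only [y, if_pos (Set.mem_Iic.1 hk), if_pos (Set.mem_Iic.1 hl)] at h
    linear_combination h
  filter_upwards [hball, hne] with t h1 h2
  refine ⟨fun k => ?_, fun k l hk hl => h2 k hk l hl⟩
  by_cases hk : k ≤ n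
  · exact h1 k hk
  · simpa [y, hk] using hx k

end Density

section Extension

/-- `Φ m` is, for each `m ≤ h`, a continuous extension to `B ^ (m + 1)` of the `m`-th difference
quotient of `f`. -/
structure IsDqExtension {L : Type*} [NontriviallyNormedField L] (f : L → L) (B : Set L) (h : ℕ) (Φ : ℕ → (ℕ → L) → L) : Prop where
  dep : ∀ m ≤ h, ∀ x y : ℕ → L, (∀ i ≤ m, x i = y i) → Φ m x = Φ m y
  cont : ∀ m ≤ h, ContinuousOn (Φ m) {x : ℕ → L | ∀ i, x i ∈ B}
  ext : ∀ m ≤ h, ∀ x : ℕ → L, (∀ i, x i ∈ B) →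
    (∀ i j, i ≤ m → j ≤ m → i ≠ j → x i ≠ x j) → Φ m x = dq f m x

/-- The value of the family `Φ` at the tuple formed by the elements of a multiset. -/
noncomputable def multisetValue {L : Type*} (Φ : ℕ → (ℕ → L) → L) (a₀ : L) (s : Multiset L) : L :=
  Φ (s.card - 1) (fun k => s.toList.getD k a₀)

theorem getD_mem_of_forall {L : Type*} {B : Set L} {a₀ : L} (ha₀ : a₀ ∈ B) {l : List L} (hl : ∀ z ∈ l, z ∈ B)
    (k : ℕ) : l.getD k a₀ ∈ B := by
  rcases lt_or_ge k l.length with hk | hk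
  · rw [List.getD_eq_getElem _ _ hk]
    exact hl _ (List.getElem_mem hk)
  · rwa [List.getD_eq_default _ _ hk]

variable {L : Type*} [NontriviallyNormedField L] [IsUltrametricDist L] {a₀ : L} {r : ℝ} {f : L → L} {h : ℕ} {Φ : ℕ → (ℕ → L) → L}

namespace IsDqExtension

theorem apply_perm (hΦ : IsDqExtension f (Metric.closedBall a₀ r) h Φ) (hr : 0 < r) {n : ℕ}
    (hn : n ≤ h) {p : List ℕ} (hp : p.Perm (List.range (n + 1))) {x : ℕ → L}
    (hx : ∀ k, x k ∈ Metric.closedBall a₀ r) : Φ n (fun k => x (p.getD k 0)) = Φ n x := by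
  have hlen : p.length = n + 1 := by simpa using hp.length_eq
  refine Set.EqOn.of_subset_closure (f := fun x : ℕ → L => Φ n (fun k => x (p.getD k 0)))
    ?_ ?_ (hΦ.cont n hn) (fun _ hy => hy.1) (subset_closure_distinct a₀ hr n) hx
  · rintro y ⟨hy, hne⟩
    have := dq_perm f n y hne hp
    dsimp only
    rw [hΦ.ext n hn y hy hne, hΦ.ext n hn _ (fun k => hy _), this]
    intro k l hk hl hkl
    have hk' : k < p.length := by omega
    have hl' : l < p.length := by omega
    have bound : ∀ m (h : m < p.length), p[m] ≤ n := fun m h => by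
      have := hp.mem_iff.1 (List.getElem_mem h)
      rw [List.mem_range] at this
      omega
    simp only [List.getD_eq_getElem _ _ hk', List.getD_eq_getElem _ _ hl']
    exact hne _ _ (bound _ _) (bound _ _)
      fun h => hkl (((hp.nodup_iff.2 List.nodup_range).getElem_inj_iff).1 h)
  · exact (hΦ.cont n hn).comp (by fun_prop) fun y hy k => hy _

theorem sub_eq_mul (hΦ : IsDqExtension f (Metric.closedBall a₀ r) h Φ) (hr : 0 < r) {n : ℕ}
    (hn : n + 1 ≤ h) {x : ℕ → L} (hx : ∀ k, x k ∈ Metric.closedBall a₀ r) :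
    Φ n (fun i => if i = 0 then x 0 else x (i + 1)) - Φ n (fun i => x (i + 1)) =
      (x 0 - x 1) * Φ (n + 1) x := by
  have hcont : Continuous fun (x : ℕ → L) (i : ℕ) => if i = 0 then x 0 else x (i + 1) :=
    continuous_pi fun i => by split_ifs <;> fun_prop
  have hmem : ∀ y : ℕ → L, (∀ k, y k ∈ Metric.closedBall a₀ r) →
      ∀ i, (if i = 0 then y 0 else y (i + 1)) ∈ Metric.closedBall a₀ r := fun y hy i => by
    split_ifs <;> exact hy _
  refine Set.EqOn.of_subset_closure
    (f := fun x : ℕ → L =>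
      Φ n (fun i => if i = 0 then x 0 else x (i + 1)) - Φ n (fun i => x (i + 1)))
    (g := fun x : ℕ → L => (x 0 - x 1) * Φ (n + 1) x)
    ?_ ?_ ?_ (fun _ hy => hy.1) (subset_closure_distinct a₀ hr (n + 1)) hx
  · rintro y ⟨hy, hne⟩
    dsimp only
    rw [hΦ.ext (n + 1) hn y hy hne, dq, mul_div_cancel₀ _
      (sub_ne_zero.2 (hne 0 1 (by omega) (by omega) (by omega))),
      hΦ.ext n (by omega) _ (hmem y hy), hΦ.ext n (by omega) _ fun k => hy _]
    · intro k l hk hl hkl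
      exact hne _ _ (by omega) (by omega) (by omega)
    · intro k l hk hl hkl
      split_ifs <;> exact hne _ _ (by omega) (by omega) (by omega)
  · exact ((hΦ.cont n (by omega)).comp hcont.continuousOn hmem).sub
      ((hΦ.cont n (by omega)).comp (by fun_prop) fun y hy k => hy _)
  · exact ContinuousOn.mul (by fun_prop) (hΦ.cont (n + 1) hn)

theorem multisetValue_coe (hΦ : IsDqExtension f (Metric.closedBall a₀ r) h Φ) (hr : 0 < r)
    {l : List L} (hl : ∀ z ∈ l, z ∈ Metric.closedBall a₀ r) {n : ℕ} (hn : n ≤ h)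
    (hlen : l.length = n + 1) :
    multisetValue Φ a₀ l = Φ n (fun k => l.getD k a₀) := by
  have hcard : Multiset.card (l : Multiset L) - 1 = n := by simp [hlen]
  rw [multisetValue, hcard]
  set l' := (l : Multiset L).toList
  have hperm : l'.Perm l := Multiset.coe_eq_coe.1 (Multiset.coe_toList _)
  have hmap : l = (List.range (n + 1)).map fun k => l.getD k a₀ := by
    refine List.ext_getElem (by simp [hlen]) fun k hk _ => by simp [hk]
  have hcomp : (Relation.Comp (· = List.map (fun k => l.getD k a₀) ·) (·.Perm ·)) l'
      (List.range (n + 1)) := by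
    rw [List.eq_map_comp_perm]
    exact hperm.trans (List.Perm.of_eq hmap)
  obtain ⟨p, hp', hp⟩ := hcomp
  rw [← hΦ.apply_perm hr hn hp (getD_mem_of_forall (Metric.mem_closedBall_self hr.le) hl)]
  refine hΦ.dep n hn _ _ fun k hk => ?_
  have hk' : k < p.length := by rw [hp.length_eq, List.length_range]; omega
  rw [hp', List.getD_eq_getElem _ _ (by simpa using hk'), List.getD_eq_getElem p _ hk',
    List.getElem_map]

theorem isDividedDiff (hΦ : IsDqExtension f (Metric.closedBall a₀ r) h Φ) (hr : 0 < r) :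
    IsDividedDiff (Subtype.val : Metric.closedBall a₀ r → L)
      (fun s => multisetValue Φ a₀ (s.map Subtype.val)) (h + 1) := by
  intro s a b hs
  induction s using Quotient.inductionOn with | _ l
  simp only [Multiset.quot_mk_to_coe, Multiset.coe_card] at hs
  have hmem : ∀ l : List (Metric.closedBall a₀ r), ∀ z ∈ l.map Subtype.val,
      z ∈ Metric.closedBall a₀ r := fun _ => List.forall_mem_map.2 fun y _ => y.2
  have key := hΦ.sub_eq_mul hr (n := l.length) (by omega)
    (getD_mem_of_forall (Metric.mem_closedBall_self hr.le) (hmem (a :: b :: l)))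
  simp only [Multiset.quot_mk_to_coe, Multiset.cons_coe, Multiset.map_coe]
  rw [hΦ.multisetValue_coe hr (hmem _) (n := l.length) (by omega) (by simp),
    hΦ.multisetValue_coe hr (hmem _) (n := l.length) (by omega) (by simp),
    hΦ.multisetValue_coe hr (hmem _) (n := l.length + 1) (by omega) (by simp)]
  convert key using 4 with k
  · cases k <;> rfl
  all_goals rfl

theorem continuous_multisetValue (hΦ : IsDqExtension f (Metric.closedBall a₀ r) h Φ) (hr : 0 < r)
    (m : Multiset ℕ) (hm : 0 < m.card) (hm' : m.card ≤ h + 1) :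
    Continuous fun u : ℕ → Metric.closedBall a₀ r =>
      multisetValue Φ a₀ ((m.map u).map Subtype.val) := by
  induction m using Quotient.inductionOn with | _ l
  simp only [Multiset.quot_mk_to_coe, Multiset.coe_card] at hm hm'
  obtain ⟨n, hn⟩ := Nat.exists_eq_add_one.2 hm
  have hl : ∀ u : ℕ → Metric.closedBall a₀ r, ∀ z ∈ (l.map u).map Subtype.val,
      z ∈ Metric.closedBall a₀ r := fun _ => List.forall_mem_map.2 fun y _ => y.2
  simp only [Multiset.quot_mk_to_coe, Multiset.map_coe]
  simp only [fun u => hΦ.multisetValue_coe hr (hl u) (n := n) (by omega) (by simp [hn])]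
  refine (hΦ.cont n (by omega)).comp_continuous (continuous_pi fun k => ?_) fun u =>
    getD_mem_of_forall (Metric.mem_closedBall_self hr.le) (hl u)
  rcases lt_or_ge k l.length with hk | hk
  · simp only [List.map_map, List.getD_eq_getElem?_getD, List.getElem?_map,
      List.getElem?_eq_getElem hk, Option.map_some, Option.getD_some, Function.comp_apply]
    fun_prop
  · simp only [List.map_map, List.getD_eq_getElem?_getD, List.getElem?_map,
      List.getElem?_eq_none hk, Option.map_none, Option.getD_none]
    fun_prop

theorem multisetValue_replicate (hΦ : IsDqExtension f (Metric.closedBall a₀ r) h Φ) (hr : 0 < r)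
    {n : ℕ} (hn : n ≤ h) {y : L} (hy : y ∈ Metric.closedBall a₀ r) :
    multisetValue Φ a₀ (Multiset.replicate (n + 1) y) = Φ n (fun _ => y) := by
  rw [← Multiset.coe_replicate, hΦ.multisetValue_coe hr
    (fun z hz => (List.eq_of_mem_replicate hz).symm ▸ hy) hn (by simp)]
  refine hΦ.dep n hn _ _ fun k hk => ?_
  rw [List.getD_eq_getElem _ _ (by simp; omega), List.getElem_replicate]

end IsDqExtension

end Extension

/-- if `f ∈ C^h(B)` on a closed ball `B` (i.e. each difference quotient
`Φ_m f`, `m ≤ h`, extends continuously to `B^{m+1}`, with hyperderivatives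
`D_m f x = Φ̄_m f (x,…,x)`), then for `i + j ≤ h` the function `D_j f` is `C^i` on `B`
and `D_i (D_j f) = C(i+j, i) · D_{i+j} f`. -/
theorem stmt9 (L : Type*) [NontriviallyNormedField L] [IsUltrametricDist L] [CompleteSpace L]
    (a₀ : L) (r : ℝ) (hr : 0 < r) (B : Set L) (hB : B = Metric.closedBall a₀ r)
    (f : L → L) (h : ℕ)
    (Φbar : ℕ → (ℕ → L) → L)
    (hdep : ∀ m ≤ h, ∀ x y : ℕ → L, (∀ i ≤ m, x i = y i) → Φbar m x = Φbar m y)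
    (hcont : ∀ m ≤ h, ContinuousOn (Φbar m) {x : ℕ → L | ∀ i, x i ∈ B})
    (hext : ∀ m ≤ h, ∀ x : ℕ → L, (∀ i, x i ∈ B) →
      (∀ i j, i ≤ m → j ≤ m → i ≠ j → x i ≠ x j) → Φbar m x = dq f m x)
    (i j : ℕ) (hij : i + j ≤ h) :
    ∃ Ψ : (ℕ → L) → L,
      ContinuousOn Ψ {x : ℕ → L | ∀ k, x k ∈ B} ∧
      (∀ x : ℕ → L, (∀ k, x k ∈ B) → (∀ k l, k ≤ i → l ≤ i → k ≠ l → x k ≠ x l) →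
        Ψ x = dq (fun y => Φbar j (fun _ => y)) i x) ∧
      (∀ x ∈ B, Ψ (fun _ => x) = ((i + j).choose i : L) * Φbar (i + j) (fun _ => x)) := by
  subst hB
  have hΦ : IsDqExtension f (Metric.closedBall a₀ r) h Φbar := ⟨hdep, hcont, hext⟩
  let F : Multiset (Metric.closedBall a₀ r) → L := fun s =>
    multisetValue Φbar a₀ (s.map Subtype.val)
  have hF : IsDividedDiff Subtype.val F (h + 1) := hΦ.isDividedDiff hr
  have hconst : ∀ n ≤ h, ∀ b, F (Multiset.replicate (n + 1) b) = Φbar n (fun _ => b.1) := by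
    intro n hn b
    simp only [F, Multiset.map_replicate]
    exact hΦ.multisetValue_replicate hr hn b.2
  have ha₀ : a₀ ∈ Metric.closedBall a₀ r := Metric.mem_closedBall_self hr.le
  classical
  let π : L → Metric.closedBall a₀ r := fun y =>
    if hy : y ∈ Metric.closedBall a₀ r then ⟨y, hy⟩ else ⟨a₀, ha₀⟩
  have hπ : ∀ y (hy : y ∈ Metric.closedBall a₀ r), π y = ⟨y, hy⟩ := fun y hy => dif_pos hy
  refine ⟨fun x => repeatSum F i (fun k => π (x k)) 0 j, ?_, ?_, ?_⟩
  · have hc := continuous_repeatSum (F := F) (N := h + 1) (hΦ.continuous_multisetValue hr) i j id 0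
      (by simp; omega)
    rw [continuousOn_iff_continuous_domRestrict]
    convert hc.comp (f := fun (x : {x : ℕ → L | ∀ k, x k ∈ Metric.closedBall a₀ r}) k =>
      (⟨x.1 k, x.2 k⟩ : Metric.closedBall a₀ r))
      (continuous_pi fun k =>
        ((continuous_apply k).comp continuous_subtype_val).subtype_mk _) using 1
    ext x
    simp [hπ _ (x.2 _)]
  · intro x hx hne
    have hπx : ∀ k, (π (x k) : L) = x k := fun k => by rw [hπ _ (hx k)]
    dsimp only
    rw [repeatSum_eq_dq hF (g := fun y => Φbar j (fun _ => y)) (hconst j (by omega)) i (by omega)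
      (fun k => π (x k)) (by simpa only [hπx] using hne)]
    simp only [hπx]
  · intro x hx
    have := repeatSum_const F (π x) i j 0
    rw [Multiset.replicate_zero, add_zero, hconst _ hij, hπ x hx] at this
    simpa only [hπ x hx] using this
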